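/- Let e₁ = (1/2)·!![1,1,1,1; 1,1,-1,-1; 1,-1,1,-1; 1,-1,-1,1], e₂ = diag(1,1,1,-1), e₃ = !![1,0,0,0; 0,1,0,0; 0,0,0,1; 0,0,1,0], e₄ = !![1,0,0,0; 0,0,1,0; 0,1,0,0; 0,0,0,1] be 4×4 real matrices. Then the subgroup of GL(4,ℝ) generated by e₁, e₂, e₃, e₄ is isomorphic to the Weyl group W(F₄), i.e. to the Coxeter group with presentation ⟨a,b,c,d | a² = b² = c² = d² = 1, (ab)³ = (bc)⁴ = (cd)³ = 1, (ac)² = (ad)² = (bd)² = 1⟩. -/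

import Mathlib

/-- The relations of the Coxeter presentation of the Weyl group `W(F₄)`:
`a² = b² = c² = d² = 1`, `(ab)³ = (bc)⁴ = (cd)³ = 1`, `(ac)² = (ad)² = (bd)² = 1`. -/
def F4Rels : Set (FreeGroup (Fin 4)) :=
  let a := FreeGroup.of (0 : Fin 4)
  let b := FreeGroup.of (1 : Fin 4)
  let c := FreeGroup.of (2 : Fin 4)
  let d := FreeGroup.of (3 : Fin 4)
  {a ^ 2, b ^ 2, c ^ 2, d ^ 2, (a * b) ^ 3, (b * c) ^ 4, (c * d) ^ 3,
    (a * c) ^ 2, (a * d) ^ 2, (b * d) ^ 2}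

/-! ### String rewriting modulo the Coxeter relations -/

namespace F4

/-- The element of the Coxeter group represented by a word in the generators. -/
def wordProd (w : List (Fin 4)) : PresentedGroup F4Rels :=
  (w.map PresentedGroup.of).prod

@[simp]
lemma wordProd_nil : wordProd [] = 1 := rfl

@[simp]
lemma wordProd_cons (a : Fin 4) (w : List (Fin 4)) :
    wordProd (a :: w) = PresentedGroup.of a * wordProd w := by
  simp [wordProd]

@[simp]
lemma wordProd_append (u v : List (Fin 4)) : wordProd (u ++ v) = wordProd u * wordProd v := by
  simp [wordProd]

/-- A rewriting rule, from its first to its second component. -/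
abbrev Rule := List (Fin 4) × List (Fin 4)

/-- Apply the first applicable rule of `R` at the leftmost possible position. -/
def rewriteStep (R : List Rule) : List (Fin 4) → Option (List (Fin 4))
  | [] => none
  | a :: w =>
    match R.find? fun p => p.1.isPrefixOf (a :: w) with
    | some p => some (p.2 ++ (a :: w).drop p.1.length)
    | none => (rewriteStep R w).map (a :: ·)

/-- Rewrite a word by the rules of `R`, with at most `n` steps. -/
def rewrite (R : List Rule) : ℕ → List (Fin 4) → List (Fin 4)
  | 0, w => w
  | n + 1, w =>
    match rewriteStep R w with
    | some v => rewrite R n v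
    | none => w

/-- A list of rules is sound if both sides of every rule represent the same group element. -/
def Sound (R : List Rule) : Prop := ∀ p ∈ R, wordProd p.1 = wordProd p.2

lemma Sound.wordProd_rewriteStep {R : List Rule} (hR : Sound R) {w v : List (Fin 4)}
    (h : rewriteStep R w = some v) : wordProd v = wordProd w := by
  induction w generalizing v with
  | nil => simp [rewriteStep] at h
  | cons a w ih =>
    rw [rewriteStep] at h
    split at h
    · rename_i p hp
      obtain rfl := Option.some.inj h
      have hpre : p.1 <+: a :: w := by
        simpa using List.find?_some hp
      obtain ⟨u, hu⟩ := hpre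
      have hp' := hR p (List.mem_of_find?_eq_some hp)
      simp only [← hu, List.drop_left, wordProd_append, hp']
    · obtain ⟨u, hu, rfl⟩ := Option.map_eq_some_iff.mp h
      rw [wordProd_cons, wordProd_cons, ih hu]

lemma Sound.wordProd_rewrite {R : List Rule} (hR : Sound R) (n : ℕ) (w : List (Fin 4)) :
    wordProd (rewrite R n w) = wordProd w := by
  induction n generalizing w with
  | zero => rfl
  | succ n ih =>
    rw [rewrite]
    split
    · rename_i v hv
      rw [ih, hR.wordProd_rewriteStep hv]
    · rfl

/-- The rules cancelling the square of a generator. -/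
def squareRules : List Rule := [([0, 0], []), ([1, 1], []), ([2, 2], []), ([3, 3], [])]

/-- The braid relations, oriented towards the lexicographically smaller side. -/
def braidRules : List Rule :=
  [([2, 0], [0, 2]), ([3, 0], [0, 3]), ([3, 1], [1, 3]), ([1, 0, 1], [0, 1, 0]),
    ([2, 1, 2, 1], [1, 2, 1, 2]), ([3, 2, 3], [2, 3, 2])]

/-- The Coxeter relations, oriented towards the lexicographically smaller side. -/
def coxeterRules : List Rule := squareRules ++ braidRules

/-- The Coxeter relations, oriented towards the lexicographically larger side. -/
def coxeterRulesRev : List Rule := squareRules ++ braidRules.map Prod.swap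

lemma of_mul_self (i : Fin 4) :
    (PresentedGroup.of i * PresentedGroup.of i : PresentedGroup F4Rels) = 1 := by
  have h : FreeGroup.of i ^ 2 ∈ F4Rels := by
    fin_cases i <;> simp [F4Rels]
  simpa [pow_two, PresentedGroup.of] using PresentedGroup.one_of_mem h

lemma inv_of (i : Fin 4) :
    (PresentedGroup.of i : PresentedGroup F4Rels)⁻¹ = PresentedGroup.of i :=
  inv_eq_of_mul_eq_one_left (of_mul_self i)

lemma of_mul_pow {i j : Fin 4} {m : ℕ} (h : (FreeGroup.of i * FreeGroup.of j) ^ m ∈ F4Rels) :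
    (PresentedGroup.of i * PresentedGroup.of j : PresentedGroup F4Rels) ^ m = 1 := by
  simpa [PresentedGroup.of] using PresentedGroup.one_of_mem h

lemma braid_two {i j : Fin 4} (h : (FreeGroup.of i * FreeGroup.of j) ^ 2 ∈ F4Rels) :
    wordProd [j, i] = wordProd [i, j] := by
  have h := of_mul_pow h
  rw [pow_two, mul_eq_one_iff_eq_inv] at h
  simpa [inv_of] using h.symm

lemma braid_three {i j : Fin 4} (h : (FreeGroup.of i * FreeGroup.of j) ^ 3 ∈ F4Rels) :
    wordProd [j, i, j] = wordProd [i, j, i] := by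
  have h := of_mul_pow h
  rw [show ∀ x y : PresentedGroup F4Rels, (x * y) ^ 3 = (x * y * x) * (y * x * y) by
    simp [pow_succ, mul_assoc], mul_eq_one_iff_eq_inv] at h
  simpa [inv_of, mul_assoc] using h.symm

lemma braid_four {i j : Fin 4} (h : (FreeGroup.of i * FreeGroup.of j) ^ 4 ∈ F4Rels) :
    wordProd [j, i, j, i] = wordProd [i, j, i, j] := by
  have h := of_mul_pow h
  rw [pow_add _ 2 2, mul_eq_one_iff_eq_inv] at h
  simpa [inv_of, mul_assoc, pow_two] using h.symm

lemma sound_squareRules : Sound squareRules := by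
  simp [Sound, squareRules, of_mul_self]

lemma sound_braidRules : Sound braidRules := by
  simp only [Sound, braidRules, List.forall_mem_cons, List.not_mem_nil, false_imp_iff,
    implies_true, and_true]
  refine ⟨braid_two ?_, braid_two ?_, braid_two ?_, braid_three ?_, braid_four ?_, braid_three ?_⟩
    <;> simp [F4Rels]

lemma Sound.append {R S : List Rule} (hR : Sound R) (hS : Sound S) : Sound (R ++ S) :=
  List.forall_mem_append.mpr ⟨hR, hS⟩

lemma Sound.map_swap {R : List Rule} (hR : Sound R) : Sound (R.map Prod.swap) := by
  intro p hp
  obtain ⟨q, hq, rfl⟩ := List.mem_map.mp hp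
  exact (hR q hq).symm

lemma sound_coxeterRules : Sound coxeterRules := sound_squareRules.append sound_braidRules

lemma sound_coxeterRulesRev : Sound coxeterRulesRev :=
  sound_squareRules.append sound_braidRules.map_swap

/-- Consequences of the Coxeter relations needed to enumerate the parabolic cosets. -/
def derivedRules : List Rule :=
  [([2, 1, 0, 2, 1, 0], [1, 2, 1, 0, 2, 1]),
    ([3, 2, 1, 0, 2, 1, 2, 3, 2, 1, 2, 3],
      [2, 3, 2, 1, 0, 2, 1, 2, 3, 2, 1, 2])]

lemma sound_derivedRules : Sound derivedRules := by
  have key (w : List (Fin 4)) :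
      wordProd (rewrite coxeterRules 20 (rewrite coxeterRulesRev 20 w)) = wordProd w := by
    rw [sound_coxeterRules.wordProd_rewrite, sound_coxeterRulesRev.wordProd_rewrite]
  simp only [Sound, derivedRules, List.forall_mem_cons, List.not_mem_nil, false_imp_iff,
    implies_true, and_true]
  constructor
  · exact (key [2, 1, 0, 2, 1, 0]).symm
  · let w : List (Fin 4) := [3, 2, 1, 0, 2, 1, 3, 2, 1, 3, 2, 3]
    calc
      _ = wordProd w := key w
      _ = wordProd (rewrite coxeterRules 20 w) := (sound_coxeterRules.wordProd_rewrite 20 w).symm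
      _ = _ := (key _).symm

/-- The rules used for the coset enumeration. -/
def cosetRules : List Rule := coxeterRules ++ derivedRules

lemma sound_cosetRules : Sound cosetRules := sound_coxeterRules.append sound_derivedRules

/-! ### Coset enumeration along a chain of parabolic subgroups -/

/-- The word `w` is in `reps`, possibly after deleting a first letter belonging to `T`. -/
def IsCosetWord (T : List (Fin 4)) (reps : List (List (Fin 4))) : List (Fin 4) → Prop
  | [] => [] ∈ reps
  | t :: w => t :: w ∈ reps ∨ t ∈ T ∧ w ∈ reps

instance (T : List (Fin 4)) (reps : List (List (Fin 4))) :
    DecidablePred (IsCosetWord T reps)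
  | [] => by unfold IsCosetWord; infer_instance
  | _ :: _ => by unfold IsCosetWord; infer_instance

/-- The words in `reps` are closed under right multiplication by the generators in `S`, up to left
multiplication by an element of `T`; this is checked by rewriting. -/
def IsTransversal (S T : List (Fin 4)) (reps : List (List (Fin 4))) : Prop :=
  ∀ r ∈ reps, ∀ s ∈ S, ∃ w ∈ [r ++ [s], rewrite coxeterRulesRev 40 (r ++ [s])],
    IsCosetWord T reps (rewrite cosetRules 40 w)

instance (S T : List (Fin 4)) (reps : List (List (Fin 4))) :
    Decidable (IsTransversal S T reps) := by
  unfold IsTransversal; infer_instance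

/-- The standard parabolic subgroup generated by the generators in `S`. -/
def parabolic (S : List (Fin 4)) : Subgroup (PresentedGroup F4Rels) :=
  Subgroup.closure {g | ∃ s ∈ S, PresentedGroup.of s = g}

lemma of_mem_parabolic {S : List (Fin 4)} {s : Fin 4} (hs : s ∈ S) :
    PresentedGroup.of s ∈ parabolic S :=
  Subgroup.subset_closure ⟨s, hs, rfl⟩

lemma IsCosetWord.exists_eq_mul {T : List (Fin 4)} {reps : List (List (Fin 4))}
    {w : List (Fin 4)} (h : IsCosetWord T reps w) :
    ∃ t ∈ parabolic T, ∃ r ∈ reps, wordProd w = t * wordProd r := by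
  rcases w with _ | ⟨t, w⟩
  · exact ⟨1, one_mem _, [], h, by simp⟩
  · rcases h with h | ⟨ht, h⟩
    · exact ⟨1, one_mem _, t :: w, h, by simp⟩
    · exact ⟨.of t, of_mem_parabolic ht, w, h, wordProd_cons t w⟩

lemma IsTransversal.exists_eq_mul {S T : List (Fin 4)} {reps : List (List (Fin 4))}
    (h : IsTransversal S T reps) (h_nil : [] ∈ reps) {g : PresentedGroup F4Rels}
    (hg : g ∈ parabolic S) : ∃ t ∈ parabolic T, ∃ r ∈ reps, g = t * wordProd r := by
  have step : ∀ g : PresentedGroup F4Rels, ∀ s ∈ S,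
      (∃ t ∈ parabolic T, ∃ r ∈ reps, g = t * wordProd r) →
      ∃ t ∈ parabolic T, ∃ r ∈ reps, g * PresentedGroup.of s = t * wordProd r := by
    rintro _ s hs ⟨t, ht, r, hr, rfl⟩
    obtain ⟨w, hw, hw'⟩ := h r hr s hs
    obtain ⟨u, hu, r', hr', hur⟩ := hw'.exists_eq_mul
    have hrs : wordProd r * PresentedGroup.of s = u * wordProd r' := by
      rw [← hur, sound_cosetRules.wordProd_rewrite]
      simp only [List.mem_cons, List.not_mem_nil, or_false] at hw
      rcases hw with rfl | rfl <;> simp [sound_coxeterRulesRev.wordProd_rewrite]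
    exact ⟨t * u, mul_mem ht hu, r', hr', by rw [mul_assoc, hrs, mul_assoc]⟩
  induction hg using Subgroup.closure_induction_right with
  | one => exact ⟨1, one_mem _, [], h_nil, by simp⟩
  | mul_right g _ s hs ih =>
    obtain ⟨s, hs, rfl⟩ := hs
    exact step g s hs ih
  | mul_inv_cancel g _ s hs ih =>
    obtain ⟨s, hs, rfl⟩ := hs
    rw [inv_of]
    exact step g s hs ih

/-! ### The reflection representation -/

/-- The matrices of the generating reflections. -/
def reflMatrix : Fin 4 → Matrix (Fin 4) (Fin 4) ℚ :=
  ![(1/2 : ℚ) • !![1,1,1,1; 1,1,-1,-1; 1,-1,1,-1; 1,-1,-1,1],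
    Matrix.diagonal ![1,1,1,-1],
    !![1,0,0,0; 0,1,0,0; 0,0,0,1; 0,0,1,0],
    !![1,0,0,0; 0,0,1,0; 0,1,0,0; 0,0,0,1]]

lemma reflMatrix_mul_self (i : Fin 4) : reflMatrix i * reflMatrix i = 1 := by
  revert i; decide +kernel

/-- The generating reflections. -/
def refl (i : Fin 4) : GL (Fin 4) ℚ :=
  ⟨reflMatrix i, reflMatrix i, reflMatrix_mul_self i, reflMatrix_mul_self i⟩

lemma lift_refl_eq_one : ∀ r ∈ F4Rels, FreeGroup.lift refl r = 1 := by
  simp only [F4Rels, Set.mem_insert_iff, Set.mem_singleton_iff, forall_eq_or_imp, forall_eq,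
    map_pow, map_mul, FreeGroup.lift_apply_of, Units.ext_iff, Units.val_pow_eq_pow_val,
    Units.val_mul, Units.val_one, refl]
  decide +kernel

/-- The reflection representation of the Coxeter group of type `F₄`. -/
def reflRep : PresentedGroup F4Rels →* GL (Fin 4) ℚ :=
  PresentedGroup.toGroup lift_refl_eq_one

@[simp]
lemma reflRep_of (i : Fin 4) : reflRep (PresentedGroup.of i) = refl i :=
  PresentedGroup.toGroup.of _

/-- The generating reflections acting on vectors, in coordinates. -/
def act (i : Fin 4) (v : Fin 4 → ℚ) : Fin 4 → ℚ :=
  ![![(v 0 + v 1 + v 2 + v 3) / 2, (v 0 + v 1 - v 2 - v 3) / 2,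
      (v 0 - v 1 + v 2 - v 3) / 2, (v 0 - v 1 - v 2 + v 3) / 2],
    ![v 0, v 1, v 2, -v 3],
    ![v 0, v 1, v 3, v 2],
    ![v 0, v 2, v 1, v 3]] i

lemma reflMatrix_mulVec (i : Fin 4) (v : Fin 4 → ℚ) : (reflMatrix i).mulVec v = act i v := by
  ext j
  fin_cases i <;> fin_cases j <;>
    simp [reflMatrix, act, Matrix.mulVec, dotProduct, Fin.sum_univ_four] <;> ring

/-- The action of a word on a vector through the reflection representation. -/
def actWord (w : List (Fin 4)) (v : Fin 4 → ℚ) : Fin 4 → ℚ :=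
  w.foldr act v

lemma reflRep_wordProd_mulVec (w : List (Fin 4)) (v : Fin 4 → ℚ) :
    (reflRep (wordProd w)).val.mulVec v = actWord w v := by
  induction w with
  | nil => simp [actWord]
  | cons a w ih =>
    rw [wordProd_cons, map_mul, Units.val_mul, ← Matrix.mulVec_mulVec, ih, reflRep_of]
    exact reflMatrix_mulVec a _

lemma mulVec_eq_of_mem_parabolic {T : List (Fin 4)} {v : Fin 4 → ℚ}
    (hv : ∀ t ∈ T, actWord [t] v = v) {g : PresentedGroup F4Rels} (hg : g ∈ parabolic T) :
    (reflRep g).val.mulVec v = v := by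
  induction hg using Subgroup.closure_induction with
  | mem g hg =>
    obtain ⟨t, ht, rfl⟩ := hg
    rw [reflRep_of]
    exact (reflMatrix_mulVec t v).trans (hv t ht)
  | one => simp
  | mul g h _ _ hg hh => rw [map_mul, Units.val_mul, ← Matrix.mulVec_mulVec, hh, hg]
  | inv g _ hg =>
    nth_rw 1 [← hg]
    rw [Matrix.mulVec_mulVec, ← Units.val_mul, ← map_mul]
    simp

/-- If a vector `v` is fixed by the generators in `T` and moved by all nontrivial coset
representatives, then an element of the larger parabolic subgroup acting trivially lies in the
smaller one. -/
lemma IsTransversal.mem_parabolic {S T : List (Fin 4)} {reps : List (List (Fin 4))}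
    (h : IsTransversal S T reps) (h_nil : [] ∈ reps) {v : Fin 4 → ℚ}
    (hv : ∀ t ∈ T, actWord [t] v = v) (hr : ∀ r ∈ reps, actWord r v = v → r = [])
    {g : PresentedGroup F4Rels} (hg : g ∈ parabolic S) (h_one : reflRep g = 1) :
    g ∈ parabolic T := by
  obtain ⟨t, ht, r, hr', rfl⟩ := h.exists_eq_mul h_nil hg
  have hfix : actWord r v = v := by
    rw [← reflRep_wordProd_mulVec, ← inv_mul_cancel_left t (wordProd r), map_mul, h_one, mul_one]
    exact mulVec_eq_of_mem_parabolic hv (inv_mem ht)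
  simpa [hr r hr' hfix] using ht

/-- Representatives of the cosets of the parabolic subgroup of type `B₃`. -/
def repsF4 : List (List (Fin 4)) :=
  [[], [3], [3, 2], [3, 2, 1], [3, 2, 1, 0], [3, 2, 1, 2], [3, 2, 1, 0, 2], [3, 2, 1, 2, 3],
    [3, 2, 1, 0, 2, 1], [3, 2, 1, 0, 2, 3], [3, 2, 1, 0, 2, 1, 2], [3, 2, 1, 0, 2, 1, 3],
    [3, 2, 1, 0, 2, 1, 2, 3], [3, 2, 1, 0, 2, 1, 3, 2], [3, 2, 1, 0, 2, 1, 2, 3, 2],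
    [3, 2, 1, 0, 2, 1, 3, 2, 1], [3, 2, 1, 0, 2, 1, 2, 3, 2, 1], [3, 2, 1, 0, 2, 1, 3, 2, 1, 0],
    [3, 2, 1, 0, 2, 1, 2, 3, 2, 1, 0], [3, 2, 1, 0, 2, 1, 2, 3, 2, 1, 2],
    [3, 2, 1, 0, 2, 1, 2, 3, 2, 1, 0, 2], [3, 2, 1, 0, 2, 1, 2, 3, 2, 1, 0, 2, 1],
    [3, 2, 1, 0, 2, 1, 2, 3, 2, 1, 0, 2, 1, 2], [3, 2, 1, 0, 2, 1, 2, 3, 2, 1, 0, 2, 1, 2, 3]]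

lemma reflRep_injective : Function.Injective reflRep := by
  rw [injective_iff_map_eq_one]
  intro g hg
  have h4 : g ∈ parabolic [0, 1, 2, 3] := by
    have h := PresentedGroup.closure_range_of F4Rels ▸ Subgroup.mem_top g
    refine Subgroup.closure_mono ?_ h
    rintro _ ⟨i, rfl⟩
    exact ⟨i, by fin_cases i <;> simp, rfl⟩
  have h3 : g ∈ parabolic [0, 1, 2] :=
    IsTransversal.mem_parabolic (reps := repsF4) (v := ![1, 1, 0, 0]) (by decide +kernel)
      (by decide +kernel) (by decide +kernel) (by decide +kernel) h4 hg
  have h2 : g ∈ parabolic [0, 1] :=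
    IsTransversal.mem_parabolic (reps := [[], [2], [2, 1], [2, 1, 0], [2, 1, 2], [2, 1, 0, 2],
      [2, 1, 0, 2, 1], [2, 1, 0, 2, 1, 2]]) (v := ![1, 0, 1, 0]) (by decide +kernel)
      (by decide +kernel) (by decide +kernel) (by decide +kernel) h3 hg
  have h1 : g ∈ parabolic [0] :=
    IsTransversal.mem_parabolic (reps := [[], [1], [1, 0]]) (v := ![0, 0, 1, -1])
      (by decide +kernel) (by decide +kernel) (by decide +kernel) (by decide +kernel) h2 hg
  have h0 : g ∈ parabolic [] :=
    IsTransversal.mem_parabolic (reps := [[], [0]]) (v := ![1, 0, 0, 0])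
      (by decide +kernel) (by decide +kernel) (by decide +kernel) (by decide +kernel) h1 hg
  simpa [parabolic] using h0

/-- The reflection representation over `ℝ`. -/
noncomputable def realReflRep : PresentedGroup F4Rels →* GL (Fin 4) ℝ :=
  (Matrix.GeneralLinearGroup.map (algebraMap ℚ ℝ)).comp reflRep

lemma realReflRep_injective : Function.Injective realReflRep := by
  have h_map : Function.Injective
      (Matrix.GeneralLinearGroup.map (n := Fin 4) (algebraMap ℚ ℝ)) := by
    intro A B h
    ext i j
    have := congrArg (fun M : GL (Fin 4) ℝ => M.val i j) h
    simpa using this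
  exact h_map.comp reflRep_injective

lemma realReflRep_of (i : Fin 4) :
    (realReflRep (PresentedGroup.of i) : Matrix (Fin 4) (Fin 4) ℝ) =
      (reflMatrix i).map (algebraMap ℚ ℝ) := by
  simp only [realReflRep, MonoidHom.comp_apply, reflRep_of]
  rfl

lemma range_realReflRep : realReflRep.range =
    Subgroup.closure {realReflRep (.of 0), realReflRep (.of 1), realReflRep (.of 2),
      realReflRep (.of 3)} := by
  rw [MonoidHom.range_eq_map, ← PresentedGroup.closure_range_of, MonoidHom.map_closure,
    ← Set.range_comp]
  congr 1
  ext g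
  simp [Fin.exists_fin_succ, eq_comm]

end F4

theorem stmt_4 :
    let e₁ : Matrix (Fin 4) (Fin 4) ℝ :=
      (1/2 : ℝ) • !![1,1,1,1; 1,1,-1,-1; 1,-1,1,-1; 1,-1,-1,1]
    let e₂ : Matrix (Fin 4) (Fin 4) ℝ := Matrix.diagonal ![1,1,1,-1]
    let e₃ : Matrix (Fin 4) (Fin 4) ℝ := !![1,0,0,0; 0,1,0,0; 0,0,0,1; 0,0,1,0]
    let e₄ : Matrix (Fin 4) (Fin 4) ℝ := !![1,0,0,0; 0,0,1,0; 0,1,0,0; 0,0,0,1]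
    ∃ g₁ g₂ g₃ g₄ : GL (Fin 4) ℝ,
      (g₁ : Matrix (Fin 4) (Fin 4) ℝ) = e₁ ∧ (g₂ : Matrix (Fin 4) (Fin 4) ℝ) = e₂ ∧
      (g₃ : Matrix (Fin 4) (Fin 4) ℝ) = e₃ ∧ (g₄ : Matrix (Fin 4) (Fin 4) ℝ) = e₄ ∧
      Nonempty ((Subgroup.closure {g₁, g₂, g₃, g₄} : Subgroup (GL (Fin 4) ℝ)) ≃*
        PresentedGroup F4Rels) := by
  intro e₁ e₂ e₃ e₄
  refine ⟨F4.realReflRep (.of 0), F4.realReflRep (.of 1), F4.realReflRep (.of 2),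
    F4.realReflRep (.of 3), ?_, ?_, ?_, ?_, ⟨?_⟩⟩
  any_goals
    rw [F4.realReflRep_of]
    ext i j
    fin_cases i <;> fin_cases j <;> simp [F4.reflMatrix, e₁, e₂, e₃, e₄]
  rw [← F4.range_realReflRep]
  exact (MonoidHom.ofInjective F4.realReflRep_injective).symm
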